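/- arXiv:1903.08351 — 8 statements merged into one kernel-verified Lean document; each statement's English description precedes it below -/
import Mathlib

section
/- Let U and L be finite sets, let w : U × L → ℝ be a non-negative weight function, and let p be a positive integer. Define the set function g on finite subsets S of U by g(S) = Σ_{ℓ∈L} maxᵖ_{x∈S} w(x,ℓ), where maxᵖ_{x∈S} w(x,ℓ) denotes the sum of the p largest numbers in the multiset {w(x,ℓ) : x ∈ S} (the sum of all of them if |S| < p), and g(∅) = 0. Then g is non-negative, monotone, and submodular. -/
/-- `maxp p m` is the sum of the `p` largest numbers in the multiset `m` of reals
(the sum of all of them if `m` has fewer than `p` elements). -/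
noncomputable def maxp (p : ℕ) (m : Multiset ℝ) : ℝ :=
  ((m.sort (· ≤ ·)).drop (Multiset.card m - p)).sum

/-- The `(p + 1)`-st largest element of `m`, or `0` if `m` has at most `p` elements. -/
noncomputable def nthLargest (p : ℕ) (m : Multiset ℝ) : ℝ :=
  (m.sort (· ≥ ·)).getD p 0

theorem maxp_eq_sum_take (p : ℕ) (m : Multiset ℝ) :
    maxp p m = ((m.sort (· ≥ ·)).take p).sum := by
  have h : m.sort (· ≥ ·) = (m.sort (· ≤ ·)).reverse := by
    refine List.Perm.eq_of_pairwise' (Multiset.pairwise_sort m _)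
      (List.pairwise_reverse.2 (Multiset.pairwise_sort m (· ≤ ·))) ?_
    rw [← Multiset.coe_eq_coe, Multiset.coe_reverse, Multiset.sort_eq, Multiset.sort_eq]
  rw [h, List.take_reverse, List.sum_reverse, Multiset.length_sort, maxp]

theorem sort_cons_eq_orderedInsert (a : ℝ) (m : Multiset ℝ) :
    (a ::ₘ m).sort (· ≥ ·) = (m.sort (· ≥ ·)).orderedInsert (· ≥ ·) a := by
  refine List.Perm.eq_of_pairwise' (Multiset.pairwise_sort _ _)
    ((Multiset.pairwise_sort m _).orderedInsert a _) ?_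
  rw [← Multiset.coe_eq_coe, Multiset.sort_eq,
    Multiset.coe_eq_coe.2 (List.perm_orderedInsert _ a _), ← Multiset.cons_coe,
    Multiset.sort_eq]

theorem sum_take_succ_eq_add_getD (l : List ℝ) (p : ℕ) :
    (l.take (p + 1)).sum = (l.take p).sum + l.getD p 0 := by
  induction l generalizing p with
  | nil => simp
  | cons b l ih =>
    cases p with
    | zero => simp
    | succ q => simp only [List.take_succ_cons, List.sum_cons, List.getD_cons_succ, ih q]; ring

theorem getD_le_of_forall_le {l : List ℝ} {c : ℝ} (hc : 0 ≤ c) (h : ∀ y ∈ l, y ≤ c) (p : ℕ) :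
    l.getD p 0 ≤ c := by
  rcases lt_or_ge p l.length with hp | hp
  · rw [List.getD_eq_getElem _ _ hp]
    exact h _ (List.getElem_mem hp)
  · rwa [List.getD_eq_default _ _ hp]

theorem sum_take_orderedInsert {l : List ℝ} (hl : l.Pairwise (· ≥ ·)) {a : ℝ} (ha : 0 ≤ a)
    (p : ℕ) :
    ((l.orderedInsert (· ≥ ·) a).take (p + 1)).sum =
      (l.take (p + 1)).sum + max 0 (a - l.getD p 0) := by
  induction l generalizing p with
  | nil => simp [ha]
  | cons b l ih =>
    obtain ⟨hb, hl⟩ := List.pairwise_cons.1 hl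
    by_cases hab : a ≥ b
    · have h : (b :: l).getD p 0 ≤ a :=
        getD_le_of_forall_le ha (List.forall_mem_cons.2 ⟨hab, fun y hy => (hb y hy).trans hab⟩) p
      rw [List.orderedInsert_cons_of_le _ _ hab, sum_take_succ_eq_add_getD (b :: l),
        max_eq_right (sub_nonneg.2 h), List.take_succ_cons, List.sum_cons]
      ring
    · rw [List.orderedInsert_of_not_le _ _ hab]
      cases p with
      | zero => simp [le_of_not_ge hab]
      | succ q =>
        simp only [List.take_succ_cons (i := q + 1), List.sum_cons, List.getD_cons_succ, ih hl q]
        ring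

theorem getD_le_getD_orderedInsert {l : List ℝ} (hl : l.Pairwise (· ≥ ·))
    (h0 : ∀ y ∈ l, 0 ≤ y) {a : ℝ} (ha : 0 ≤ a) (p : ℕ) :
    l.getD p 0 ≤ (l.orderedInsert (· ≥ ·) a).getD p 0 := by
  induction l generalizing p a with
  | nil => cases p <;> simp [ha]
  | cons b l ih =>
    obtain ⟨hb, hl⟩ := List.pairwise_cons.1 hl
    obtain ⟨hb0, h0⟩ := List.forall_mem_cons.1 h0
    by_cases hab : a ≥ b
    · rw [List.orderedInsert_cons_of_le _ _ hab]
      cases p with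
      | zero => simpa using hab
      | succ q =>
        have hcons : l.orderedInsert (· ≥ ·) b = b :: l := by
          cases l with
          | nil => rfl
          | cons c l => exact List.orderedInsert_cons_of_le _ _ (hb c List.mem_cons_self)
        simpa [hcons] using ih hl h0 hb0 q
    · rw [List.orderedInsert_of_not_le _ _ hab]
      cases p with
      | zero => simp
      | succ q => simpa using ih hl h0 ha q

theorem maxp_cons (p : ℕ) (m : Multiset ℝ) {a : ℝ} (ha : 0 ≤ a) :
    maxp (p + 1) (a ::ₘ m) = maxp (p + 1) m + max 0 (a - nthLargest p m) := by
  rw [maxp_eq_sum_take, maxp_eq_sum_take, sort_cons_eq_orderedInsert,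
    sum_take_orderedInsert (Multiset.pairwise_sort m _) ha, nthLargest]

theorem maxp_nonneg (p : ℕ) {m : Multiset ℝ} (h0 : ∀ y ∈ m, 0 ≤ y) : 0 ≤ maxp p m :=
  List.sum_nonneg fun y hy => h0 y ((Multiset.mem_sort _).1 (List.mem_of_mem_drop hy))

theorem nthLargest_le_of_le (p : ℕ) {m n : Multiset ℝ} (hmn : m ≤ n) (h0 : ∀ y ∈ n, 0 ≤ y) :
    nthLargest p m ≤ nthLargest p n := by
  obtain ⟨k, rfl⟩ := Multiset.le_iff_exists_add.1 hmn
  clear hmn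
  induction k using Multiset.induction_on with
  | empty => simp
  | cons a k ih =>
    rw [Multiset.add_cons] at h0 ⊢
    obtain ⟨ha, h0⟩ := Multiset.forall_mem_cons.1 h0
    refine (ih h0).trans ?_
    rw [nthLargest, nthLargest, sort_cons_eq_orderedInsert]
    exact getD_le_getD_orderedInsert (Multiset.pairwise_sort _ _)
      (fun y hy => h0 y ((Multiset.mem_sort _).1 hy)) ha p

theorem maxp_le_of_le (p : ℕ) {m n : Multiset ℝ} (hmn : m ≤ n) (h0 : ∀ y ∈ n, 0 ≤ y) :
    maxp (p + 1) m ≤ maxp (p + 1) n := by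
  obtain ⟨k, rfl⟩ := Multiset.le_iff_exists_add.1 hmn
  clear hmn
  induction k using Multiset.induction_on with
  | empty => simp
  | cons a k ih =>
    rw [Multiset.add_cons] at h0 ⊢
    obtain ⟨ha, h0⟩ := Multiset.forall_mem_cons.1 h0
    rw [maxp_cons p _ ha]
    exact (ih h0).trans (le_add_of_nonneg_right (le_max_left _ _))

/-- with `U` and `L` finite, `w : U × L → ℝ` non-negative and `p` a positive
integer, the set function `g S = ∑_{ℓ ∈ L} maxᵖ_{x ∈ S} w (x, ℓ)` is non-negative,
monotone, and submodular. -/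
theorem stmt0 {U L : Type*} [Fintype U] [Fintype L] [DecidableEq U]
    (w : U × L → ℝ) (hw : ∀ x ℓ, 0 ≤ w (x, ℓ)) (p : ℕ) (hp : 0 < p)
    (g : Finset U → ℝ)
    (hg : ∀ S : Finset U, g S = ∑ ℓ : L, maxp p (S.val.map fun x => w (x, ℓ))) :
    (∀ S : Finset U, 0 ≤ g S) ∧
    (∀ A B : Finset U, A ⊆ B → g A ≤ g B) ∧
    (∀ A B : Finset U, A ⊆ B → ∀ x ∉ B,
      g (insert x B) - g B ≤ g (insert x A) - g A) := by
  obtain ⟨p, rfl⟩ := Nat.exists_eq_succ_of_ne_zero hp.ne'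
  have h0 (S : Finset U) (ℓ : L) : ∀ y ∈ S.val.map fun x => w (x, ℓ), 0 ≤ y := by
    intro y hy
    obtain ⟨x, -, rfl⟩ := Multiset.mem_map.1 hy
    exact hw x ℓ
  have hle {A B : Finset U} (hAB : A ⊆ B) (ℓ : L) :
      (A.val.map fun x => w (x, ℓ)) ≤ B.val.map fun x => w (x, ℓ) :=
    Multiset.map_le_map (Finset.val_le_iff.2 hAB)
  refine ⟨fun S => ?_, fun A B hAB => ?_, fun A B hAB x hx => ?_⟩
  · rw [hg]
    exact Finset.sum_nonneg fun ℓ _ => maxp_nonneg _ (h0 S ℓ)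
  · rw [hg, hg]
    exact Finset.sum_le_sum fun ℓ _ => maxp_le_of_le p (hle hAB ℓ) (h0 B ℓ)
  · simp only [hg, ← Finset.sum_sub_distrib]
    refine Finset.sum_le_sum fun ℓ _ => ?_
    rw [Finset.insert_val_of_notMem hx, Finset.insert_val_of_notMem (fun h => hx (hAB h)),
      Multiset.map_cons, Multiset.map_cons, Nat.succ_eq_add_one, maxp_cons p _ (hw x ℓ),
      maxp_cons p _ (hw x ℓ), add_sub_cancel_left, add_sub_cancel_left]
    exact max_le_max_left 0 (sub_le_sub_left (nthLargest_le_of_le p (hle hAB ℓ) (h0 B ℓ)) _)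
end

section
/- Let U and L be finite sets, w : U × L → ℝ non-negative, and p a positive integer. For a finite S ⊆ U and ℓ ∈ L let maxᵖ_{x∈S} w(x,ℓ) be the sum of the p largest numbers in {w(x,ℓ) : x ∈ S}. Then for each fixed ℓ ∈ L, the set function S ↦ maxᵖ_{x∈S} w(x,ℓ) is submodular: for all S ⊆ T ⊆ U and a ∈ U∖T, maxᵖ_{x∈S∪{a}} w(x,ℓ) − maxᵖ_{x∈S} w(x,ℓ) ≥ maxᵖ_{x∈T∪{a}} w(x,ℓ) − maxᵖ_{x∈T} w(x,ℓ). -/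
theorem List.Sublist.sum_le_sum_drop_of_pairwise {l' l : List ℝ} (h : l'.Sublist l)
    (hl : l.Pairwise (· ≤ ·)) (h0 : ∀ x ∈ l, 0 ≤ x) {p : ℕ} (hp : l'.length ≤ p) :
    l'.sum ≤ (l.drop (l.length - p)).sum := by
  induction h generalizing p with
  | slnil => simp
  | @cons s t x h ih =>
    rw [List.pairwise_cons] at hl
    have key := ih hl.2 (fun y hy => h0 y (by simp [hy])) hp
    by_cases hlen : t.length + 1 ≤ p
    · rw [List.length_cons, Nat.sub_eq_zero_of_le hlen]
      rw [Nat.sub_eq_zero_of_le (by omega)] at key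
      have := h0 x (by simp)
      simp only [List.drop_zero, List.sum_cons] at key ⊢
      linarith
    · rw [List.length_cons, show t.length + 1 - p = (t.length - p) + 1 by omega,
        List.drop_succ_cons]
      exact key
  | @cons_cons s t x h ih =>
    rw [List.pairwise_cons] at hl
    rw [List.length_cons] at hp
    have key := ih hl.2 (fun y hy => h0 y (by simp [hy])) (p := p - 1) (by omega)
    by_cases hlen : t.length + 1 ≤ p
    · rw [List.length_cons, Nat.sub_eq_zero_of_le hlen]
      rw [Nat.sub_eq_zero_of_le (by omega)] at key
      simp only [List.drop_zero, List.sum_cons] at key ⊢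
      linarith
    · have hlt : t.length - p < t.length := by omega
      rw [List.length_cons, show t.length + 1 - p = (t.length - p) + 1 by omega,
        List.drop_succ_cons, List.drop_eq_getElem_cons hlt, List.sum_cons, List.sum_cons]
      rw [show t.length - (p - 1) = t.length - p + 1 by omega] at key
      have := hl.1 _ (List.getElem_mem hlt)
      linarith

theorem exists_le_sum_eq_maxp (p : ℕ) (m : Multiset ℝ) :
    ∃ A ≤ m, Multiset.card A ≤ p ∧ A.sum = maxp p m := by
  refine ⟨((m.sort (· ≤ ·)).drop (Multiset.card m - p) : List ℝ), ?_, ?_, by simp [maxp]⟩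
  · conv_rhs => rw [← Multiset.sort_eq m (· ≤ ·)]
    exact (List.drop_sublist _ _).subperm
  · simp only [Multiset.coe_card, List.length_drop, Multiset.length_sort]
    omega

theorem sum_le_maxp {p : ℕ} {A m : Multiset ℝ} (h : A ≤ m) (h0 : ∀ x ∈ m, 0 ≤ x)
    (hp : Multiset.card A ≤ p) : A.sum ≤ maxp p m := by
  have hsub : (A.sort (· ≤ ·)).Sublist (m.sort (· ≤ ·)) := by
    apply List.sublist_of_subperm_of_pairwise _ (Multiset.pairwise_sort _ _)
      (Multiset.pairwise_sort _ _)
    rwa [← Multiset.coe_le, Multiset.sort_eq, Multiset.sort_eq]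
  have key := hsub.sum_le_sum_drop_of_pairwise (Multiset.pairwise_sort _ _)
    (fun x hx => h0 x (by simpa using hx)) (p := p) (by simpa using hp)
  rw [Multiset.length_sort] at key
  rw [← Multiset.sort_eq A (· ≤ ·), Multiset.sum_coe]
  exact key

/-- Adding two elements to a multiset gains at most the sum of the separate gains. -/
theorem maxp_cons_cons_add_le (p : ℕ) (a b : ℝ) (m : Multiset ℝ) (ha : 0 ≤ a) (hb : 0 ≤ b)
    (h0 : ∀ x ∈ m, 0 ≤ x) :
    maxp p (a ::ₘ b ::ₘ m) + maxp p m ≤ maxp p (a ::ₘ m) + maxp p (b ::ₘ m) := by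
  have ham : ∀ x ∈ a ::ₘ m, 0 ≤ x := by
    simpa [ha] using h0
  have hbm : ∀ x ∈ b ::ₘ m, 0 ≤ x := by
    simpa [hb] using h0
  obtain ⟨A, hA, hAp, hAs⟩ := exists_le_sum_eq_maxp p (a ::ₘ b ::ₘ m)
  obtain ⟨B, hB, hBp, hBs⟩ := exists_le_sum_eq_maxp p m
  rw [← hAs, ← hBs]
  have exchange {C D : Multiset ℝ} (hC : C ≤ a ::ₘ m) (hD : D ≤ b ::ₘ m)
      (hCp : Multiset.card C ≤ p) (hDp : Multiset.card D ≤ p) :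
      C.sum + D.sum ≤ maxp p (a ::ₘ m) + maxp p (b ::ₘ m) :=
    add_le_add (sum_le_maxp hC ham hCp) (sum_le_maxp hD hbm hDp)
  by_cases haA : A ≤ b ::ₘ m
  · rw [add_comm]
    exact exchange (hB.trans (Multiset.le_cons_self _ _)) haA hBp hAp
  by_cases hbA : A ≤ a ::ₘ m
  · exact exchange hbA (hB.trans (Multiset.le_cons_self _ _)) hAp hBp
  have haA' : a ∈ A := by
    by_contra h
    exact haA ((Multiset.le_cons_of_notMem h).1 hA)
  obtain ⟨A₁, rfl⟩ := Multiset.exists_cons_of_mem haA'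
  rw [Multiset.cons_le_cons_iff] at hA hbA
  have hbA' : b ∈ A₁ := by
    by_contra h
    exact hbA ((Multiset.le_cons_of_notMem h).1 hA)
  obtain ⟨A₂, rfl⟩ := Multiset.exists_cons_of_mem hbA'
  rw [Multiset.cons_le_cons_iff] at hA
  simp only [Multiset.card_cons] at hAp
  simp only [Multiset.sum_cons]
  by_cases hlt : Multiset.card B < p
  · have := exchange (Multiset.cons_le_cons a hA) (Multiset.cons_le_cons b hB)
      (by rw [Multiset.card_cons]; omega) (by rw [Multiset.card_cons]; omega)
    simp only [Multiset.sum_cons] at this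
    linarith
  · obtain ⟨x, hx⟩ : ∃ x, A₂.count x < B.count x := by
      by_contra! h
      have := Multiset.card_le_card (Multiset.le_iff_count.2 h)
      omega
    obtain ⟨B₁, rfl⟩ := Multiset.exists_cons_of_mem
      (Multiset.count_pos.1 (Nat.zero_lt_of_lt hx))
    have hxA : x ::ₘ A₂ ≤ m := by
      rw [Multiset.le_iff_count] at hA hB ⊢
      intro y
      by_cases hy : y = x
      · subst hy
        rw [Multiset.count_cons_self]
        exact hx.trans_le (hB y)
      · rw [Multiset.count_cons_of_ne hy]
        exact hA y
    rw [Multiset.card_cons] at hBp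
    have := exchange (Multiset.cons_le_cons a hxA)
      (Multiset.cons_le_cons b ((Multiset.le_cons_self _ _).trans hB))
      (by simp only [Multiset.card_cons]; omega) (by rw [Multiset.card_cons]; omega)
    simp only [Multiset.sum_cons] at this ⊢
    linarith

theorem maxp_cons_sub_antitone (p : ℕ) (a : ℝ) (m n : Multiset ℝ) (ha : 0 ≤ a)
    (hm : ∀ x ∈ m, 0 ≤ x) (hn : ∀ x ∈ n, 0 ≤ x) :
    maxp p (a ::ₘ (n + m)) - maxp p (n + m) ≤ maxp p (a ::ₘ m) - maxp p m := by
  induction n using Multiset.induction_on with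
  | empty => simp
  | cons b n ih =>
    have hn' : ∀ x ∈ n, 0 ≤ x := fun x hx => hn x (Multiset.mem_cons_of_mem hx)
    have h := maxp_cons_cons_add_le p a b (n + m) ha (hn b (Multiset.mem_cons_self _ _))
      (fun x hx => (Multiset.mem_add.1 hx).elim (hn' x) (hm x))
    rw [Multiset.cons_add]
    linarith [ih hn']

/-- for each fixed label `ℓ`, the set function
`S ↦ maxᵖ_{x ∈ S} w (x, ℓ)` is submodular: for all `S ⊆ T ⊆ U` and `a ∈ U ∖ T`,
`maxᵖ(S ∪ {a}) − maxᵖ(S) ≥ maxᵖ(T ∪ {a}) − maxᵖ(T)`. -/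
theorem stmt1 {U L : Type*} [Fintype U] [Fintype L] [DecidableEq U]
    (w : U × L → ℝ) (hw : ∀ x ℓ, 0 ≤ w (x, ℓ)) (p : ℕ) (hp : 0 < p) (ℓ : L)
    (S T : Finset U) (hST : S ⊆ T) (a : U) (ha : a ∉ T) :
    maxp p ((insert a T).val.map fun x => w (x, ℓ))
        - maxp p (T.val.map fun x => w (x, ℓ))
      ≤ maxp p ((insert a S).val.map fun x => w (x, ℓ))
        - maxp p (S.val.map fun x => w (x, ℓ)) := by
  rw [Finset.insert_val_of_notMem ha, Finset.insert_val_of_notMem fun h => ha (hST h),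
    Multiset.map_cons, Multiset.map_cons]
  obtain ⟨n, hn⟩ := Multiset.le_iff_exists_add.1 (Finset.val_le_iff.2 hST)
  rw [hn, add_comm, Multiset.map_add]
  refine maxp_cons_sub_antitone p _ _ _ (hw a ℓ) ?_ ?_ <;>
  · intro y hy
    obtain ⟨x, -, rfl⟩ := Multiset.mem_map.1 hy
    exact hw x ℓ
end

section
/- Let d : U → U → ℝ be a metric distance on a finite set U, let g be a non-negative monotone submodular set function on U with marginal gain Δ(x,S) = g(S∪{x}) − g(S), and let D(S) = Σ_{{u,v}⊆S} d(u,v) be the sum-sum diversity. Let x_1,…,x_k be a greedy sequence for f = g + D on a subset T ⊆ U, with S_i = {x_1,…,x_i} and S_0 = ∅. Then for every t ∈ T ∖ S_k: g(S_k) + D(S_k) ≥ Σ_{i=1}^{k−1} (k−i)·d(t,x_i) + k·Δ(t,S_k). -/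
open Finset

/-- Sum-sum diversity: the sum of `d u v` over all unordered pairs of distinct
elements of `S` (each unordered pair counted once). -/
noncomputable def sumsumDiv {α : Type*} [DecidableEq α] (d : α → α → ℝ) (S : Finset α) : ℝ :=
  (∑ p ∈ S.offDiag, d p.1 p.2) / 2

/-- The prefix set `{x 0, …, x (i-1)}` of a sequence `x`. -/
def preSet {α : Type*} [DecidableEq α] {k : ℕ} (x : Fin k → α) (i : ℕ) : Finset α :=
  (Finset.univ.filter fun j : Fin k => (j : ℕ) < i).image x

/-- `x 0, …, x (k-1)` is a greedy sequence for `f = g + D` on `T`: its members are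
distinct elements of `T` and each one maximizes the marginal gain
`Δ(u, S_{i-1}) + ∑_{j < i} d (x j) u` over all `u ∈ T ∖ S_{i-1}`. -/
def IsGreedySeq {α : Type*} [DecidableEq α] (g : Finset α → ℝ) (d : α → α → ℝ)
    (T : Finset α) {k : ℕ} (x : Fin k → α) : Prop :=
  Function.Injective x ∧ (∀ j, x j ∈ T) ∧
    ∀ i : Fin k, ∀ u ∈ T \ preSet x (i : ℕ),
      (g (insert u (preSet x (i : ℕ))) - g (preSet x (i : ℕ)))
          + ∑ j ∈ Finset.univ.filter (fun j : Fin k => (j : ℕ) < (i : ℕ)), d (x j) u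
        ≤ (g (insert (x i) (preSet x (i : ℕ))) - g (preSet x (i : ℕ)))
          + ∑ j ∈ Finset.univ.filter (fun j : Fin k => (j : ℕ) < (i : ℕ)), d (x j) (x i)

lemma insert_preSet {α : Type*} [DecidableEq α] {k : ℕ} (x : Fin k → α) (i : Fin k) :
    insert (x i) (preSet x (i : ℕ)) = preSet x ((i : ℕ) + 1) := by
  unfold preSet
  rw [← Finset.image_insert]
  congr 1
  ext j
  simp only [Finset.mem_insert, Finset.mem_filter, Finset.mem_univ, true_and, Fin.ext_iff]
  omega

lemma preSet_zero {α : Type*} [DecidableEq α] {k : ℕ} (x : Fin k → α) : preSet x 0 = ∅ := by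
  simp [preSet]

lemma preSet_length {α : Type*} [DecidableEq α] {k : ℕ} (x : Fin k → α) :
    preSet x k = Finset.univ.image x := by
  simp [preSet]

lemma preSet_subset_image {α : Type*} [DecidableEq α] {k : ℕ} (x : Fin k → α) (i : ℕ) :
    preSet x i ⊆ Finset.univ.image x :=
  Finset.image_subset_image (Finset.filter_subset _ _)

/-- The marginal gains of `g` along a sequence telescope. -/
lemma sum_marginal_preSet {α : Type*} [DecidableEq α] {k : ℕ} (g : Finset α → ℝ)
    (x : Fin k → α) :
    ∑ i : Fin k, (g (insert (x i) (preSet x (i : ℕ))) - g (preSet x (i : ℕ)))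
      = g (Finset.univ.image x) - g ∅ := by
  simp_rw [insert_preSet]
  rw [Fin.sum_univ_eq_sum_range (fun n => g (preSet x (n + 1)) - g (preSet x n)) k,
    Finset.sum_range_sub (fun n => g (preSet x n)), preSet_length, preSet_zero]

/-- The sum-sum diversity of the range of an injective sequence, each pair being counted
at its later member. -/
lemma sumsumDiv_image {α : Type*} [DecidableEq α] {d : α → α → ℝ} (hd0 : ∀ u, d u u = 0)
    (hdsymm : ∀ u v, d u v = d v u) {k : ℕ} {x : Fin k → α} (hx : Function.Injective x) :
    sumsumDiv d (Finset.univ.image x)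
      = ∑ i : Fin k, ∑ j ∈ Finset.univ.filter (fun j : Fin k => (j : ℕ) < (i : ℕ)),
          d (x j) (x i) := by
  have hoff : ∀ S : Finset α, ∑ p ∈ S.offDiag, d p.1 p.2 = ∑ u ∈ S, ∑ v ∈ S, d u v := by
    intro S
    rw [← Finset.sum_product' S S d]
    refine Finset.sum_subset (fun p hp => ?_) (fun p hp hp' => ?_)
    · simp only [Finset.mem_offDiag] at hp
      exact Finset.mem_product.2 ⟨hp.1, hp.2.1⟩
    · simp only [Finset.mem_product, Finset.mem_offDiag] at hp hp'
      have : p.1 = p.2 := by tauto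
      rw [this, hd0]
  have hsplit : ∀ i j : Fin k, d (x i) (x j)
      = (if (j : ℕ) < (i : ℕ) then d (x j) (x i) else 0)
        + (if (i : ℕ) < (j : ℕ) then d (x i) (x j) else 0) := by
    intro i j
    rcases lt_trichotomy (i : ℕ) (j : ℕ) with h | h | h
    · simp [h, h.not_gt]
    · simp [Fin.ext h, hd0]
    · simp [h, h.not_gt, hdsymm (x i)]
  rw [sumsumDiv, hoff, Finset.sum_image hx.injOn]
  simp_rw [Finset.sum_image hx.injOn, Finset.sum_filter]
  rw [Finset.sum_congr rfl fun i _ => Finset.sum_congr rfl fun j _ => hsplit i j]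
  simp_rw [Finset.sum_add_distrib]
  rw [Finset.sum_comm (f := fun i j : Fin k => if (i : ℕ) < (j : ℕ) then d (x i) (x j) else 0)]
  ring

lemma sum_sum_filter_lt {k : ℕ} (c : Fin k → ℝ) :
    ∑ i : Fin k, ∑ j ∈ Finset.univ.filter (fun j : Fin k => (j : ℕ) < (i : ℕ)), c j
      = ∑ j : Fin k, ((k - 1 - (j : ℕ) : ℕ) : ℝ) * c j := by
  simp_rw [Finset.sum_filter]
  rw [Finset.sum_comm]
  refine Finset.sum_congr rfl fun j _ => ?_
  rw [← Finset.sum_filter, Finset.sum_const, nsmul_eq_mul]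
  congr 2
  rw [← Fin.card_Ioi j]
  congr 1
  ext a
  simp

/-- if `x 1, …, x k` is a greedy sequence for `f = g + D` on `T ⊆ U`
with `S_k = {x 1, …, x k}`, then for every `t ∈ T ∖ S_k`,
`g(S_k) + D(S_k) ≥ ∑_{i=1}^{k-1} (k−i)·d(t, x i) + k·Δ(t, S_k)`. -/
theorem stmt2 {α : Type*} [Fintype α] [DecidableEq α]
    (d : α → α → ℝ)
    (hd0 : ∀ u, d u u = 0) (hdnn : ∀ u v, 0 ≤ d u v)
    (hdsymm : ∀ u v, d u v = d v u)
    (hdtri : ∀ u v w, d u w ≤ d u v + d v w)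
    (g : Finset α → ℝ)
    (hgnn : ∀ S : Finset α, 0 ≤ g S)
    (hgmono : ∀ A B : Finset α, A ⊆ B → g A ≤ g B)
    (hgsub : ∀ A B : Finset α, A ⊆ B → ∀ y ∉ B,
      g (insert y B) - g B ≤ g (insert y A) - g A)
    (k : ℕ) (T : Finset α) (x : Fin k → α) (hx : IsGreedySeq g d T x)
    (t : α) (htT : t ∈ T) (htx : t ∉ Finset.univ.image x) :
    ∑ j : Fin k, ((k - 1 - (j : ℕ) : ℕ) : ℝ) * d t (x j)
        + (k : ℝ) * (g (insert t (Finset.univ.image x)) - g (Finset.univ.image x))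
      ≤ g (Finset.univ.image x) + sumsumDiv d (Finset.univ.image x) := by
  obtain ⟨hinj, -, hgreedy⟩ := hx
  have hstep : ∀ i : Fin k,
      (g (insert t (Finset.univ.image x)) - g (Finset.univ.image x))
          + ∑ j ∈ Finset.univ.filter (fun j : Fin k => (j : ℕ) < (i : ℕ)), d t (x j)
        ≤ (g (insert (x i) (preSet x (i : ℕ))) - g (preSet x (i : ℕ)))
          + ∑ j ∈ Finset.univ.filter (fun j : Fin k => (j : ℕ) < (i : ℕ)), d (x j) (x i) := by
    intro i
    have hsub := preSet_subset_image x i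
    have hgain := hgreedy i t (Finset.mem_sdiff.2 ⟨htT, fun h => htx (hsub h)⟩)
    simp_rw [hdsymm t]
    linarith [hgsub _ _ hsub t htx]
  have hsum := Finset.sum_le_sum fun i (_ : i ∈ Finset.univ) => hstep i
  rw [Finset.sum_add_distrib, Finset.sum_add_distrib, sum_marginal_preSet,
    ← sumsumDiv_image hd0 hdsymm hinj, sum_sum_filter_lt fun j => d t (x j),
    Finset.sum_const, Finset.card_univ, Fintype.card_fin, nsmul_eq_mul] at hsum
  linarith [hgnn ∅]
end

section
/- Let k ≥ 2 be an integer, let t, x_1, …, x_k be points of a finite set U, and let d : U → U → ℝ be non-negative, symmetric, and satisfy the triangle inequality. Then Σ_{i=1}^{k−1} (k−i)·d(t,x_i) + Σ_{i=⌈k/2⌉+1}^{k} Σ_{j=1}^{i−⌊k/2⌋−1} d(x_i,x_j) ≥ Σ_{i=1}^{k} (⌈k/2⌉ − 1)·d(t,x_i). -/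
open Finset

/-- Claim 1, the weight-shifting inequality: for `k ≥ 2`, points
`t, x 1, …, x k` of a finite set `U`, and `d` non-negative, symmetric, satisfying the
triangle inequality, we have
`∑_{i=1}^{k−1} (k−i)·d(t, x i) + ∑_{i=⌈k/2⌉+1}^{k} ∑_{j=1}^{i−⌊k/2⌋−1} d(x i, x j)
  ≥ ∑_{i=1}^{k} (⌈k/2⌉ − 1)·d(t, x i)`.
Here `⌈k/2⌉ = (k+1)/2` and `⌊k/2⌋ = k/2` in natural-number division. -/
theorem stmt3 {α : Type*} [Fintype α]
    (d : α → α → ℝ)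
    (hdnn : ∀ u v, 0 ≤ d u v)
    (hdsymm : ∀ u v, d u v = d v u)
    (hdtri : ∀ u v w, d u w ≤ d u v + d v w)
    (k : ℕ) (hk : 2 ≤ k) (t : α) (x : ℕ → α) :
    ∑ i ∈ Finset.Icc 1 k, (((k + 1) / 2 - 1 : ℕ) : ℝ) * d t (x i)
      ≤ ∑ i ∈ Finset.Icc 1 (k - 1), ((k - i : ℕ) : ℝ) * d t (x i)
        + ∑ i ∈ Finset.Icc ((k + 1) / 2 + 1) k,
            ∑ j ∈ Finset.Icc 1 (i - k / 2 - 1), d (x i) (x j) := by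
  obtain ⟨c, hc⟩ : ∃ c, c = (k + 1) / 2 := ⟨_, rfl⟩
  obtain ⟨f, hf⟩ : ∃ f, f = k / 2 := ⟨_, rfl⟩
  rw [← hc, ← hf]
  have split (g : ℕ → ℝ) : ∑ i ∈ Icc 1 k, g i = ∑ i ∈ Icc 1 c, g i + ∑ i ∈ Icc (c + 1) k, g i := by
    have h : Icc 1 k = Icc 1 c ∪ Icc (c + 1) k := by
      ext i
      simp only [mem_Icc, mem_union]
      omega
    rw [h, sum_union]
    rw [disjoint_left]
    intro i
    simp only [mem_Icc]
    omega
  have extend : ∑ i ∈ Icc 1 (k - 1), ((k - i : ℕ) : ℝ) * d t (x i)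
      = ∑ i ∈ Icc 1 k, ((k - i : ℕ) : ℝ) * d t (x i) := by
    apply sum_subset (Icc_subset_Icc_right (by omega))
    intro i hi hi'
    simp only [mem_Icc] at hi hi'
    rw [show k - i = 0 by omega]
    simp
  have swap : ∑ i ∈ Icc (c + 1) k, ∑ j ∈ Icc 1 (i - f - 1), d t (x j)
      = ∑ j ∈ Icc 1 c, ((c - j : ℕ) : ℝ) * d t (x j) := by
    rw [sum_comm' (t' := Icc 1 c) (s' := fun j => Icc (j + f + 1) k)]
    · refine sum_congr rfl fun j _ => ?_
      rw [sum_const, Nat.card_Icc, nsmul_eq_mul, show k + 1 - (j + f + 1) = c - j by omega]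
    · intro i j
      simp only [mem_Icc]
      omega
  have triangle : ∑ i ∈ Icc (c + 1) k, (((i - f - 1 : ℕ) : ℝ) * d t (x i)
        - ∑ j ∈ Icc 1 (i - f - 1), d t (x j))
      ≤ ∑ i ∈ Icc (c + 1) k, ∑ j ∈ Icc 1 (i - f - 1), d (x i) (x j) := by
    refine sum_le_sum fun i _ => ?_
    have h : ∑ j ∈ Icc 1 (i - f - 1), (d t (x i) - d t (x j))
        ≤ ∑ j ∈ Icc 1 (i - f - 1), d (x i) (x j) := by
      refine sum_le_sum fun j _ => ?_
      linarith [hdtri t (x j) (x i), hdsymm (x i) (x j)]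
    simpa [sum_sub_distrib] using h
  rw [sum_sub_distrib, swap] at triangle
  have low : ∑ i ∈ Icc 1 c, ((c - 1 : ℕ) : ℝ) * d t (x i)
        + ∑ i ∈ Icc 1 c, ((c - i : ℕ) : ℝ) * d t (x i)
      ≤ ∑ i ∈ Icc 1 c, ((k - i : ℕ) : ℝ) * d t (x i) := by
    rw [← sum_add_distrib]
    refine sum_le_sum fun i hi => ?_
    rw [mem_Icc] at hi
    rw [← add_mul]
    refine mul_le_mul_of_nonneg_right ?_ (hdnn _ _)
    exact_mod_cast (show c - 1 + (c - i) ≤ k - i by omega)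
  have high : ∑ i ∈ Icc (c + 1) k, ((c - 1 : ℕ) : ℝ) * d t (x i)
      = ∑ i ∈ Icc (c + 1) k, ((k - i : ℕ) : ℝ) * d t (x i)
        + ∑ i ∈ Icc (c + 1) k, ((i - f - 1 : ℕ) : ℝ) * d t (x i) := by
    rw [← sum_add_distrib]
    refine sum_congr rfl fun i hi => ?_
    rw [mem_Icc] at hi
    rw [← add_mul, ← Nat.cast_add, show k - i + (i - f - 1) = c - 1 by omega]
  rw [extend, split, split]
  linarith
end

section
/- Let d : U → U → ℝ be a metric distance on a finite set U, let g be a non-negative monotone submodular set function on U with marginal gain Δ(x,S) = g(S∪{x}) − g(S), let D be the sum-sum diversity of d, and let f = g + D. Let k ≥ 3 and let x_1,…,x_k be a greedy sequence for f on a subset T ⊆ U, with S_k = {x_1,…,x_k}. Then for every t ∈ T ∖ S_k: f(S_k ∪ {t}) − f(S_k) ≤ (2/(⌈k/2⌉ − 1))·f(S_k). -/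
open Finset

lemma sumsumDiv_insert {α : Type*} [DecidableEq α] (d : α → α → ℝ)
    (hsymm : ∀ u v, d u v = d v u) {S : Finset α} {a : α} (ha : a ∉ S) :
    sumsumDiv d (insert a S) = sumsumDiv d S + ∑ s ∈ S, d s a := by
  have hleft : Disjoint S.offDiag ({a} ×ˢ S) := by
    rw [Finset.disjoint_left]
    rintro ⟨u, v⟩ h h'
    simp only [mem_offDiag, mem_product, mem_singleton] at h h'
    exact ha (h'.1 ▸ h.1)
  have hright : Disjoint (S.offDiag ∪ {a} ×ˢ S) (S ×ˢ {a}) := by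
    rw [Finset.disjoint_left]
    rintro ⟨u, v⟩ h h'
    simp only [mem_union, mem_offDiag, mem_product, mem_singleton] at h h'
    rcases h with h | h
    · exact ha (h'.2 ▸ h.2.1)
    · exact ha (h.1 ▸ h'.1)
  have hsum : ∑ s ∈ S, d a s = ∑ s ∈ S, d s a := Finset.sum_congr rfl fun s _ => hsymm a s
  unfold sumsumDiv
  rw [Finset.offDiag_insert ha, Finset.sum_union hright, Finset.sum_union hleft,
    Finset.sum_product, Finset.sum_product]
  simp only [Finset.sum_singleton]
  rw [hsum]
  ring

lemma sumsumDiv_image_range {α : Type*} [DecidableEq α] (d : α → α → ℝ)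
    (hsymm : ∀ u v, d u v = d v u) (y : ℕ → α) (n : ℕ)
    (hy : Set.InjOn y (range n : Finset ℕ)) :
    sumsumDiv d ((range n).image y) = ∑ i ∈ range n, ∑ j ∈ range i, d (y j) (y i) := by
  induction n with
  | zero => simp [sumsumDiv]
  | succ n ih =>
    have hn : Set.InjOn y (range n : Finset ℕ) :=
      hy.mono (by exact_mod_cast range_subset_range.2 n.le_succ)
    have hnot : y n ∉ (range n).image y := by
      intro h
      obtain ⟨j, hj, hjn⟩ := Finset.mem_image.1 h
      have hj' := Finset.mem_range.1 hj
      have : j = n := hy (by simp; omega) (by simp) hjn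
      omega
    rw [range_add_one, image_insert, sumsumDiv_insert d hsymm hnot, ih hn,
      Finset.sum_image hn, Finset.sum_insert (by simp), add_comm]

/-- Pairs at distance at least `w` move weight from early to late indices, so that
every index ends up with weight at least `k - w`. -/
lemma mul_sum_le_sum_sum_range (e : ℕ → ℝ) (he : ∀ i, 0 ≤ e i) (k w : ℕ) (hw : k < 2 * w) :
    ((k - w : ℕ) : ℝ) * ∑ i ∈ range k, e i ≤
      ∑ i ∈ range k, ∑ j ∈ range i, (e j + if j + w ≤ i then e i - e j else 0) := by
  have hinner : ∀ i ∈ range k,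
      ∑ j ∈ range i, (e j + if j + w ≤ i then e i - e j else 0) =
        ∑ j ∈ range k, (if j < i ∧ i < j + w then e j else 0) +
          ∑ j ∈ range k, (if j + w ≤ i then e i else 0) := by
    intro i hi
    rw [Finset.mem_range] at hi
    have hsub : range i ⊆ range k := range_subset_range.2 hi.le
    rw [← Finset.sum_add_distrib]
    rw [← Finset.sum_subset hsub]
    · refine Finset.sum_congr rfl fun j hj => ?_
      rw [Finset.mem_range] at hj
      by_cases h : j + w ≤ i
      · have h' : ¬ (j < i ∧ i < j + w) := by omega
        simp [h, h']
      · have h' : j < i ∧ i < j + w := by omega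
        simp [h, h']
    · intro j _ hj
      rw [Finset.mem_range] at hj
      have h : ¬ j + w ≤ i := by omega
      have h' : ¬ (j < i ∧ i < j + w) := by omega
      simp [h, h']
  rw [Finset.sum_congr rfl hinner, Finset.sum_add_distrib, Finset.sum_comm,
    ← Finset.sum_add_distrib, Finset.mul_sum]
  refine Finset.sum_le_sum fun i hi => ?_
  rw [Finset.mem_range] at hi
  rw [← Finset.sum_filter, ← Finset.sum_filter, Finset.sum_const, Finset.sum_const,
    nsmul_eq_mul, nsmul_eq_mul, ← add_mul]
  refine mul_le_mul_of_nonneg_right ?_ (he i)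
  have hnear : (Ioo i (min k (i + w))).card ≤ #{j ∈ range k | i < j ∧ j < i + w} := by
    refine Finset.card_le_card fun j hj => ?_
    simp only [mem_Ioo, mem_filter, mem_range] at hj ⊢
    omega
  have hfar : (range (i + 1 - w)).card ≤ #{j ∈ range k | j + w ≤ i} := by
    refine Finset.card_le_card fun j hj => ?_
    simp only [mem_filter, mem_range] at hj ⊢
    omega
  rw [Nat.card_Ioo] at hnear
  rw [Finset.card_range] at hfar
  have : k - w ≤ #{j ∈ range k | i < j ∧ j < i + w} + #{j ∈ range k | j + w ≤ i} := by omega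
  exact_mod_cast this

/-- The marginal bound for a sequence each of whose elements gains at least as much as `t`. -/
lemma mul_marginal_le_two_mul {α : Type*} [DecidableEq α]
    (d : α → α → ℝ) (hdnn : ∀ u v, 0 ≤ d u v) (hdsymm : ∀ u v, d u v = d v u)
    (hdtri : ∀ u v w, d u w ≤ d u v + d v w)
    (g : Finset α → ℝ) (hgnn : ∀ S : Finset α, 0 ≤ g S)
    (hgmono : ∀ A B : Finset α, A ⊆ B → g A ≤ g B)
    (hgsub : ∀ A B : Finset α, A ⊆ B → ∀ y ∉ B,
      g (insert y B) - g B ≤ g (insert y A) - g A)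
    (k w : ℕ) (hw : k < 2 * w) (y : ℕ → α) (hy : Set.InjOn y (range k : Finset ℕ))
    (t : α) (ht : t ∉ (range k).image y)
    (hgreedy : ∀ i < k,
      (g (insert t ((range i).image y)) - g ((range i).image y)) + ∑ j ∈ range i, d (y j) t ≤
        (g (insert (y i) ((range i).image y)) - g ((range i).image y)) +
          ∑ j ∈ range i, d (y j) (y i)) :
    ((k - w : ℕ) : ℝ) *
        ((g (insert t ((range k).image y)) + sumsumDiv d (insert t ((range k).image y))) -
          (g ((range k).image y) + sumsumDiv d ((range k).image y))) ≤
      2 * (g ((range k).image y) + sumsumDiv d ((range k).image y)) := by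
  rw [sumsumDiv_insert d hdsymm ht, Finset.sum_image hy]
  set S := (range k).image y with hS
  set δ := g (insert t S) - g S with hδ
  have hδ0 : 0 ≤ δ := sub_nonneg.2 (hgmono _ _ (Finset.subset_insert t S))
  have htel : ∑ i ∈ range k, (g (insert (y i) ((range i).image y)) - g ((range i).image y)) =
      g S - g ∅ := by
    have h := Finset.sum_range_sub (fun i => g ((range i).image y)) k
    simpa only [range_add_one, image_insert, range_zero, image_empty] using h
  have hD := sumsumDiv_image_range d hdsymm y k hy
  have hgain : ∑ i ∈ range k, (δ + ∑ j ∈ range i, d (y j) t) ≤ g S + sumsumDiv d S := by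
    calc
      _ ≤ ∑ i ∈ range k, ((g (insert (y i) ((range i).image y)) - g ((range i).image y)) +
          ∑ j ∈ range i, d (y j) (y i)) := by
        refine Finset.sum_le_sum fun i hi => ?_
        have hik := Finset.mem_range.1 hi
        have hle := hgsub _ _ (Finset.image_subset_image (f := y)
          (range_subset_range.2 hik.le)) t ht
        have := hgreedy i hik
        linarith
      _ = g S - g ∅ + sumsumDiv d S := by rw [Finset.sum_add_distrib, htel, hD]
      _ ≤ _ := by linarith [hgnn ∅]
  have hdist : ∑ i ∈ range k, ∑ j ∈ range i,
      (if j + w ≤ i then d (y i) t - d (y j) t else 0) ≤ g S + sumsumDiv d S := by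
    have : ∑ i ∈ range k, ∑ j ∈ range i,
        (if j + w ≤ i then d (y i) t - d (y j) t else 0) ≤ sumsumDiv d S := by
      rw [hD]
      refine Finset.sum_le_sum fun i _ => Finset.sum_le_sum fun j _ => ?_
      split_ifs
      · linarith [hdtri (y i) (y j) t, hdsymm (y i) (y j)]
      · exact hdnn _ _
    linarith [hgnn S]
  have hcomb := mul_sum_le_sum_sum_range (fun i => d (y i) t) (fun i => hdnn _ _) k w hw
  simp only [Finset.sum_add_distrib, Finset.sum_const, Finset.card_range, nsmul_eq_mul]
    at hcomb hgain
  have hcast : ((k - w : ℕ) : ℝ) ≤ k := by exact_mod_cast Nat.sub_le k w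
  have hmul := mul_le_mul_of_nonneg_right hcast hδ0
  have hgoal : (g (insert t S) + (sumsumDiv d S + ∑ i ∈ range k, d (y i) t)) -
      (g S + sumsumDiv d S) = δ + ∑ i ∈ range k, d (y i) t := by rw [hδ]; ring
  rw [hgoal, mul_add]
  linarith

/-- if `k ≥ 3` and `x 1, …, x k` is a greedy sequence for `f = g + D` on
`T ⊆ U` with `S_k = {x 1, …, x k}`, then for every `t ∈ T ∖ S_k`,
`f(S_k ∪ {t}) − f(S_k) ≤ (2/(⌈k/2⌉ − 1))·f(S_k)`, where `⌈k/2⌉ = (k+1)/2`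
in natural-number division. -/
theorem stmt5 {α : Type*} [Fintype α] [DecidableEq α]
    (d : α → α → ℝ)
    (hd0 : ∀ u, d u u = 0) (hdnn : ∀ u v, 0 ≤ d u v)
    (hdsymm : ∀ u v, d u v = d v u)
    (hdtri : ∀ u v w, d u w ≤ d u v + d v w)
    (g : Finset α → ℝ)
    (hgnn : ∀ S : Finset α, 0 ≤ g S)
    (hgmono : ∀ A B : Finset α, A ⊆ B → g A ≤ g B)
    (hgsub : ∀ A B : Finset α, A ⊆ B → ∀ y ∉ B,
      g (insert y B) - g B ≤ g (insert y A) - g A)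
    (k : ℕ) (hk : 3 ≤ k) (T : Finset α) (x : Fin k → α) (hx : IsGreedySeq g d T x)
    (t : α) (htT : t ∈ T) (htx : t ∉ Finset.univ.image x) :
    (g (insert t (Finset.univ.image x)) + sumsumDiv d (insert t (Finset.univ.image x)))
        - (g (Finset.univ.image x) + sumsumDiv d (Finset.univ.image x))
      ≤ 2 / ((((k + 1) / 2 : ℕ) : ℝ) - 1)
          * (g (Finset.univ.image x) + sumsumDiv d (Finset.univ.image x)) := by
  obtain ⟨hinj, hxT, hgr⟩ := hx
  let y : ℕ → α := fun n => if h : n < k then x ⟨n, h⟩ else t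
  have hyx : ∀ j : Fin k, y j = x j := fun j => by simp [y]
  have himage : ∀ i ≤ k, preSet x i = (range i).image y := by
    intro i hi
    ext a
    simp only [preSet, Finset.mem_image, mem_filter, Finset.mem_univ, true_and, mem_range]
    constructor
    · rintro ⟨j, hj, rfl⟩
      exact ⟨j, hj, hyx j⟩
    · rintro ⟨j, hj, rfl⟩
      exact ⟨⟨j, by omega⟩, hj, (hyx ⟨j, by omega⟩).symm⟩
  have hsum : ∀ (i : Fin k) (u : α),
      ∑ j ∈ Finset.univ.filter (fun j : Fin k => (j : ℕ) < (i : ℕ)), d (x j) u =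
        ∑ j ∈ range i, d (y j) u := by
    intro i u
    refine Finset.sum_bij (fun j _ => (j : ℕ)) ?_ ?_ ?_ ?_
    · simp
    · intro a _ b _ h
      exact Fin.ext h
    · intro j hj
      rw [Finset.mem_range] at hj
      exact ⟨⟨j, hj.trans i.2⟩, Finset.mem_filter.2 ⟨Finset.mem_univ _, hj⟩, rfl⟩
    · intro j _
      rw [hyx]
  have hfull : Finset.univ.image x = (range k).image y := by
    rw [← himage k le_rfl, preSet]
    simp
  have hyinj : Set.InjOn y (range k : Finset ℕ) := by
    intro a ha b hb hab
    simp only [coe_range, Set.mem_Iio] at ha hb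
    have := hinj ((hyx ⟨a, ha⟩).symm.trans (hab.trans (hyx ⟨b, hb⟩)))
    simpa using this
  rw [hfull] at htx ⊢
  have hgreedy : ∀ i < k,
      (g (insert t ((range i).image y)) - g ((range i).image y)) + ∑ j ∈ range i, d (y j) t ≤
        (g (insert (y i) ((range i).image y)) - g ((range i).image y)) +
          ∑ j ∈ range i, d (y j) (y i) := by
    intro i hi
    have hnot : t ∉ (range i).image y := fun h =>
      htx (Finset.image_subset_image (range_subset_range.2 hi.le) h)
    have h := hgr ⟨i, hi⟩ t
    rw [hsum, hsum, ← hyx] at h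
    simp only [himage i hi.le] at h
    exact h (mem_sdiff.2 ⟨htT, hnot⟩)
  have key := mul_marginal_le_two_mul d hdnn hdsymm hdtri g hgnn hgmono hgsub k (k / 2 + 1)
    (by omega) y hyinj t htx hgreedy
  have hcast : ((k - (k / 2 + 1) : ℕ) : ℝ) = (((k + 1) / 2 : ℕ) : ℝ) - 1 := by
    rw [show k - (k / 2 + 1) = (k + 1) / 2 - 1 by omega, Nat.cast_sub (by omega), Nat.cast_one]
  have hpos : (0 : ℝ) < (((k + 1) / 2 : ℕ) : ℝ) - 1 := by
    rw [← hcast]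
    exact_mod_cast (by omega : 0 < k - (k / 2 + 1))
  rw [hcast] at key
  rw [div_mul_eq_mul_div, le_div_iff₀ hpos, mul_comm]
  exact key
end

section
/- Let S be a finite set with |S| = k ≥ 1, let Q be a finite set disjoint from S with |Q| ≤ k, let d : (Q ∪ S) → (Q ∪ S) → ℝ be non-negative, and let r ≥ 0. Suppose that for every q ∈ Q: Σ_{x∈S} d(q,x) ≤ (4.5/(k−1))·(k(k−1)/2)·r = (4.5k/2)·r. Then there exists an injective map e : Q → S with Σ_{q∈Q} d(q, e(q)) ≤ (4.5/2)·|Q|·r. -/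
open Finset

/-- the matching lemma, Lemma 4: if `|S| = k ≥ 1`, `Q` is disjoint from `S`
with `|Q| ≤ k`, `d` is non-negative, `r ≥ 0`, and every `q ∈ Q` satisfies
`∑_{x ∈ S} d(q, x) ≤ (4.5·k/2)·r`, then there is an injective map `e : Q → S` with
`∑_{q ∈ Q} d(q, e q) ≤ (4.5/2)·|Q|·r`. -/
theorem stmt9 {α : Type*} [DecidableEq α]
    (S Q : Finset α) (k : ℕ) (hk : 1 ≤ k) (hScard : S.card = k)
    (hdisj : Disjoint Q S) (hQcard : Q.card ≤ k)
    (d : α → α → ℝ) (hdnn : ∀ u v, 0 ≤ d u v)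
    (r : ℝ) (hr : 0 ≤ r)
    (hbound : ∀ q ∈ Q, ∑ x ∈ S, d q x ≤ 4.5 * (k : ℝ) / 2 * r) :
    ∃ e : α → α, Set.InjOn e ↑Q ∧ (∀ q ∈ Q, e q ∈ S) ∧
      ∑ q ∈ Q, d q (e q) ≤ 4.5 / 2 * (Q.card : ℝ) * r := by
  have : NeZero k := ⟨by omega⟩
  obtain ⟨g⟩ : Nonempty (ZMod k ≃ S) :=
    Fintype.card_eq.mp (by rw [ZMod.card, Fintype.card_coe, hScard])
  obtain ⟨f⟩ : Nonempty (Q ↪ ZMod k) :=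
    Function.Embedding.nonempty_of_card_le (by rw [ZMod.card, Fintype.card_coe]; exact hQcard)
  have hrow (q : Q) : ∑ s : ZMod k, d q (g (f q + s)) = ∑ x ∈ S, d q x := by
    rw [← Finset.sum_coe_sort S, ← Equiv.sum_comp ((Equiv.addLeft (f q)).trans g)]
    rfl
  have htotal : ∑ s : ZMod k, ∑ q : Q, d q (g (f q + s)) ≤
      ∑ _s : ZMod k, 4.5 / 2 * (Q.card : ℝ) * r := by
    rw [Finset.sum_comm]
    calc ∑ q : Q, ∑ s : ZMod k, d q (g (f q + s))
        ≤ ∑ _q : Q, 4.5 * (k : ℝ) / 2 * r :=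
          Finset.sum_le_sum fun q _ => (hrow q).trans_le (hbound q q.2)
      _ = ∑ _s : ZMod k, 4.5 / 2 * (Q.card : ℝ) * r := by
          simp only [Finset.sum_const, Finset.card_univ, ZMod.card, Fintype.card_coe,
            nsmul_eq_mul]
          ring
  obtain ⟨s, -, hs⟩ := Finset.exists_le_of_sum_le Finset.univ_nonempty htotal
  refine ⟨fun q => if h : q ∈ Q then g (f ⟨q, h⟩ + s) else q, ?_, ?_, ?_⟩
  · intro a ha b hb hab
    rw [Finset.mem_coe] at ha hb
    simpa [ha, hb] using hab
  · intro q hq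
    simp [hq]
  · rw [← Finset.sum_coe_sort Q]
    simpa using hs
end

section
/- Let d : U → U → ℝ be a metric distance on a finite set U, and let D(S) = Σ_{{u,v}⊆S} d(u,v) be the sum-sum diversity. Let O ⊆ U with |O| = k, and let e : O → U be a map such that every element of e(O) has at most 2 preimages in O. Then D(O) ≤ (k − 1)·Σ_{u∈O} d(u, e(u)) + 4·D(e(O)). -/
open Finset

/-- Off-diagonal sums are double sums minus the diagonal. -/
theorem sum_offDiag_eq_sum_sum_sub {α : Type*} [DecidableEq α] (f : α → α → ℝ) (S : Finset α) :
    ∑ p ∈ S.offDiag, f p.1 p.2 = ∑ u ∈ S, ∑ v ∈ S, f u v - ∑ u ∈ S, f u u := by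
  rw [← Finset.sum_product' S S f, ← Finset.diag_union_offDiag,
    Finset.sum_union (Finset.disjoint_diag_offDiag S), Finset.sum_diag]
  ring

/-- If the fibres of `e` on `S` have at most `n` elements, summing a nonnegative function
along `e` costs at most a factor `n` over summing it on the image. -/
theorem sum_comp_le_mul_sum_image {α β : Type*} [DecidableEq β] (S : Finset α) (e : α → β)
    (n : ℕ) (he : ∀ y, (S.filter fun u => e u = y).card ≤ n) (f : β → ℝ) (hf : ∀ y, 0 ≤ f y) :
    ∑ u ∈ S, f (e u) ≤ n * ∑ y ∈ S.image e, f y := by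
  rw [Finset.sum_comp f e, Finset.mul_sum]
  refine Finset.sum_le_sum fun y _ => ?_
  rw [nsmul_eq_mul]
  exact mul_le_mul_of_nonneg_right (by exact_mod_cast he y) (hf y)

/-- the mapping inequality: if `d` is a metric distance on a finite set,
`|O| = k`, and `e : O → U` is a map such that every element of `e(O)` has at most `2`
preimages in `O`, then `D(O) ≤ (k − 1)·∑_{u ∈ O} d(u, e u) + 4·D(e(O))`. -/
theorem stmt10 {α : Type*} [Fintype α] [DecidableEq α]
    (d : α → α → ℝ)
    (hd0 : ∀ u, d u u = 0) (hdnn : ∀ u v, 0 ≤ d u v)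
    (hdsymm : ∀ u v, d u v = d v u)
    (hdtri : ∀ u v w, d u w ≤ d u v + d v w)
    (O : Finset α) (k : ℕ) (hOcard : O.card = k)
    (e : α → α) (he : ∀ y : α, (O.filter fun u => e u = y).card ≤ 2) :
    sumsumDiv d O ≤ ((k : ℝ) - 1) * ∑ u ∈ O, d u (e u) + 4 * sumsumDiv d (O.image e) := by
  have hmap : ∑ u ∈ O, ∑ v ∈ O, d (e u) (e v) ≤
      4 * ∑ x ∈ O.image e, ∑ y ∈ O.image e, d x y := by
    calc ∑ u ∈ O, ∑ v ∈ O, d (e u) (e v)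
        ≤ ∑ u ∈ O, (2 : ℕ) * ∑ y ∈ O.image e, d (e u) y :=
          Finset.sum_le_sum fun u _ => sum_comp_le_mul_sum_image O e 2 he _ (hdnn (e u))
      _ = (2 : ℕ) * ∑ u ∈ O, ∑ y ∈ O.image e, d (e u) y := by rw [Finset.mul_sum]
      _ ≤ (2 : ℕ) * ((2 : ℕ) * ∑ x ∈ O.image e, ∑ y ∈ O.image e, d x y) :=
          mul_le_mul_of_nonneg_left
            (sum_comp_le_mul_sum_image O e 2 he (fun x => ∑ y ∈ O.image e, d x y)
              fun x => Finset.sum_nonneg fun y _ => hdnn x y) (Nat.cast_nonneg 2)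
      _ = 4 * ∑ x ∈ O.image e, ∑ y ∈ O.image e, d x y := by push_cast; ring
  have htri : ∑ p ∈ O.offDiag, d p.1 p.2 ≤
      ∑ p ∈ O.offDiag, (d p.1 (e p.1) + d (e p.1) (e p.2) + d p.2 (e p.2)) := by
    refine Finset.sum_le_sum fun p _ => ?_
    linarith [hdtri p.1 (e p.1) p.2, hdtri (e p.1) (e p.2) p.2, hdsymm (e p.2) p.2]
  rw [sum_offDiag_eq_sum_sum_sub
    (fun u v => d u (e u) + d (e u) (e v) + d v (e v)) O] at htri
  simp only [Finset.sum_add_distrib, Finset.sum_const, nsmul_eq_mul, hd0, hOcard,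
    ← Finset.mul_sum] at htri
  have himage := sum_offDiag_eq_sum_sum_sub d (O.image e)
  simp only [hd0, Finset.sum_const_zero, sub_zero] at himage
  unfold sumsumDiv
  rw [himage]
  linarith
end

section
/- Let d be a metric distance on a finite set U, g a non-negative monotone submodular set function on U, D the sum-sum diversity of d, f = g + D, and k ≥ 10. Let T¹,…,Tᵐ be a partition of U, let Sⁱ be the set selected by the greedy algorithm (a greedy sequence for f of length k) on Tⁱ for each i, let O be a k-subset of U maximizing f among all k-subsets of U, and let OPT(∪_{i=1}^m Sⁱ) be a k-subset of ∪_{i=1}^m Sⁱ maximizing f among k-subsets of ∪_{i=1}^m Sⁱ. Then D(O) ≤ 8.5·f(OPT(∪_{i=1}^m Sⁱ)). -/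
open Finset

section

variable {α : Type*} [DecidableEq α] {d : α → α → ℝ} {g : Finset α → ℝ}

theorem two_mul_sumsumDiv (hd0 : ∀ u, d u u = 0) (X : Finset α) :
    2 * sumsumDiv d X = ∑ u ∈ X, ∑ v ∈ X, d u v := by
  have h := Finset.sum_union (Finset.disjoint_diag_offDiag X) (f := fun p : α × α => d p.1 p.2)
  rw [Finset.diag_union_offDiag, Finset.sum_product, Finset.sum_diag] at h
  simp only [hd0, Finset.sum_const_zero, zero_add] at h
  rw [h, sumsumDiv]
  ring

theorem sumsumDiv_insert_s11 (hd0 : ∀ u, d u u = 0) (hdsymm : ∀ u v, d u v = d v u)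
    {X : Finset α} {y : α} (hy : y ∉ X) :
    sumsumDiv d (insert y X) = sumsumDiv d X + ∑ z ∈ X, d y z := by
  have h1 := two_mul_sumsumDiv hd0 (insert y X)
  have h2 := two_mul_sumsumDiv hd0 X
  have h3 : ∑ u ∈ X, d u y = ∑ u ∈ X, d y u := Finset.sum_congr rfl fun u _ => hdsymm u y
  simp only [Finset.sum_insert hy, hd0, Finset.sum_add_distrib, h3] at h1
  linarith

theorem sumsumDiv_nonneg (hdnn : ∀ u v, 0 ≤ d u v) (X : Finset α) : 0 ≤ sumsumDiv d X :=
  div_nonneg (Finset.sum_nonneg fun _ _ => hdnn _ _) zero_le_two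

theorem sumsumDiv_le_of_le_add (hd0 : ∀ u, d u u = 0) (hdsymm : ∀ u v, d u v = d v u)
    {φ : α → ℝ} (hφ : ∀ u v, d u v ≤ φ u + φ v) (X : Finset α) :
    sumsumDiv d X ≤ ((X.card : ℝ) - 1) * ∑ u ∈ X, φ u := by
  induction X using Finset.induction_on with
  | empty => simp [sumsumDiv]
  | insert y X hy ih =>
    have h : ∑ z ∈ X, d y z ≤ X.card * φ y + ∑ z ∈ X, φ z := by
      calc ∑ z ∈ X, d y z ≤ ∑ z ∈ X, (φ y + φ z) := Finset.sum_le_sum fun z _ => hφ y z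
        _ = _ := by simp [Finset.sum_add_distrib]
    rw [sumsumDiv_insert_s11 hd0 hdsymm hy, Finset.card_insert_of_notMem hy, Finset.sum_insert hy]
    push_cast
    linarith

/-- The marginal losses of the elements of a set add up to at most its value. -/
theorem sum_sub_erase_le (hgnn : ∀ S : Finset α, 0 ≤ g S)
    (hgsub : ∀ A B : Finset α, A ⊆ B → ∀ y ∉ B,
      g (insert y B) - g B ≤ g (insert y A) - g A) (P : Finset α) :
    ∑ x ∈ P, (g P - g (P.erase x)) ≤ g P := by
  have key : ∀ Q ⊆ P, ∑ x ∈ Q, (g P - g (P.erase x)) ≤ g Q := by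
    intro Q
    induction Q using Finset.induction_on with
    | empty => intro _; simpa using hgnn ∅
    | insert a Q ha ih =>
      intro hQ
      rw [Finset.insert_subset_iff] at hQ
      have h := hgsub Q (P.erase a) (Finset.subset_erase.2 ⟨hQ.2, ha⟩) a (Finset.notMem_erase a P)
      rw [Finset.insert_erase hQ.1] at h
      rw [Finset.sum_insert ha]
      linarith [ih hQ.2]
  exact key P subset_rfl

/-- Optimality under swaps bounds the distance of an outside element to an optimal set. -/
theorem sum_dist_le_of_notMem_opt
    (hd0 : ∀ u, d u u = 0) (hdsymm : ∀ u v, d u v = d v u)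
    (hgnn : ∀ S : Finset α, 0 ≤ g S)
    (hgmono : ∀ A B : Finset α, A ⊆ B → g A ≤ g B)
    (hgsub : ∀ A B : Finset α, A ⊆ B → ∀ y ∉ B,
      g (insert y B) - g B ≤ g (insert y A) - g A)
    {P V : Finset α} (hPV : P ⊆ V)
    (hP : ∀ R ⊆ V, R.card = P.card → g R + sumsumDiv d R ≤ g P + sumsumDiv d P)
    {y : α} (hyV : y ∈ V) (hyP : y ∉ P) :
    ((P.card : ℝ) - 1) * ∑ z ∈ P, d y z ≤ g P + 2 * sumsumDiv d P := by
  have swap : ∀ x ∈ P, ∑ z ∈ P, d y z ≤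
      (g P - g (P.erase x)) + d y x + ∑ z ∈ P, d x z := by
    intro x hx
    have hyE : y ∉ P.erase x := fun h => hyP (Finset.mem_of_mem_erase h)
    have hcard : (insert y (P.erase x)).card = P.card := by
      rw [Finset.card_insert_of_notMem hyE, Finset.card_erase_add_one hx]
    have h := hP (insert y (P.erase x))
      (Finset.insert_subset hyV ((Finset.erase_subset x P).trans hPV)) hcard
    have hE := sumsumDiv_insert_s11 hd0 hdsymm (Finset.notMem_erase x P)
    rw [Finset.insert_erase hx] at hE
    rw [sumsumDiv_insert_s11 hd0 hdsymm hyE] at h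
    have h1 := Finset.add_sum_erase P (fun z => d y z) hx
    have h2 := Finset.add_sum_erase P (fun z => d x z) hx
    simp only [hd0] at h1 h2
    linarith [hgmono _ _ (Finset.subset_insert y (P.erase x))]
  have h := Finset.sum_le_sum swap
  rw [Finset.sum_add_distrib, Finset.sum_add_distrib, ← two_mul_sumsumDiv hd0,
    Finset.sum_const, nsmul_eq_mul] at h
  linarith [sum_sub_erase_le hgnn hgsub P]

theorem preSet_succ {k : ℕ} (x : Fin k → α) {n : ℕ} (hn : n < k) :
    preSet x (n + 1) = insert (x ⟨n, hn⟩) (preSet x n) := by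
  have h : (Finset.univ.filter fun j : Fin k => (j : ℕ) < n + 1) =
      insert ⟨n, hn⟩ (Finset.univ.filter fun j : Fin k => (j : ℕ) < n) := by
    ext j
    simp only [Finset.mem_filter, Finset.mem_univ, true_and, Finset.mem_insert, Fin.ext_iff]
    omega
  rw [preSet, h, Finset.image_insert, preSet]

theorem preSet_self {k : ℕ} (x : Fin k → α) : preSet x k = Finset.univ.image x := by
  simp [preSet]

theorem preSet_subset {k : ℕ} (x : Fin k → α) (n : ℕ) : preSet x n ⊆ Finset.univ.image x :=
  Finset.image_subset_image (Finset.filter_subset _ _)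

theorem card_preSet {k : ℕ} {x : Fin k → α} (hx : Function.Injective x) {n : ℕ} (hn : n ≤ k) :
    (preSet x n).card = n := by
  rw [preSet, Finset.card_image_of_injective _ hx, Fin.card_filter_val_lt, min_eq_right hn]

/-- Greedy dominates: the total distance of a rejected element to all proper prefixes is at most
the value of the greedy set. -/
theorem IsGreedySeq.sum_dist_preSet_le
    (hd0 : ∀ u, d u u = 0) (hdsymm : ∀ u v, d u v = d v u)
    (hgnn : ∀ S : Finset α, 0 ≤ g S)
    (hgmono : ∀ A B : Finset α, A ⊆ B → g A ≤ g B)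
    {T : Finset α} {k : ℕ} {x : Fin k → α} (hx : IsGreedySeq g d T x)
    {b : α} (hbT : b ∈ T) (hb : b ∉ Finset.univ.image x) {n : ℕ} (hn : n ≤ k) :
    ∑ i ∈ Finset.range n, ∑ z ∈ preSet x i, d b z ≤
      g (preSet x n) + sumsumDiv d (preSet x n) := by
  obtain ⟨hinj, -, hgreedy⟩ := hx
  induction n with
  | zero => simpa [preSet, sumsumDiv] using hgnn ∅
  | succ n ih =>
    have hnk : n < k := hn
    have hnew : x ⟨n, hnk⟩ ∉ preSet x n := by
      intro h
      obtain ⟨j, hj, hjx⟩ := Finset.mem_image.1 h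
      rw [hinj hjx] at hj
      simp at hj
    have h := hgreedy ⟨n, hnk⟩ b
      (Finset.mem_sdiff.2 ⟨hbT, fun h => hb (preSet_subset x n h)⟩)
    have hsum : ∀ u, ∑ j ∈ Finset.univ.filter (fun j : Fin k => (j : ℕ) < n), d (x j) u =
        ∑ z ∈ preSet x n, d u z := by
      intro u
      rw [preSet, Finset.sum_image fun _ _ _ _ h => hinj h]
      exact Finset.sum_congr rfl fun _ _ => hdsymm _ _
    simp only [hsum] at h
    rw [Finset.sum_range_succ, preSet_succ x hnk, sumsumDiv_insert_s11 hd0 hdsymm hnew]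
    linarith [ih hnk.le, hgmono _ _ (Finset.subset_insert b (preSet x n))]

/-- An element rejected by the greedy algorithm is close to every set `P` that is optimal
among sets containing the greedy choices. -/
theorem IsGreedySeq.sum_dist_opt_le
    (hd0 : ∀ u, d u u = 0) (hdnn : ∀ u v, 0 ≤ d u v)
    (hdsymm : ∀ u v, d u v = d v u) (hdtri : ∀ u v w, d u w ≤ d u v + d v w)
    (hgnn : ∀ S : Finset α, 0 ≤ g S)
    (hgmono : ∀ A B : Finset α, A ⊆ B → g A ≤ g B)
    (hgsub : ∀ A B : Finset α, A ⊆ B → ∀ y ∉ B,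
      g (insert y B) - g B ≤ g (insert y A) - g A)
    {T P V : Finset α} {k : ℕ} (hk : 2 ≤ k) {x : Fin k → α} (hx : IsGreedySeq g d T x)
    (hxV : Finset.univ.image x ⊆ V) (hPV : P ⊆ V) (hPcard : P.card = k)
    (hP : ∀ R ⊆ V, R.card = k → g R + sumsumDiv d R ≤ g P + sumsumDiv d P)
    {b : α} (hbT : b ∈ T) (hb : b ∉ Finset.univ.image x) :
    ((k : ℝ) - 1) * ∑ z ∈ P, d b z ≤ 6 * (g P + sumsumDiv d P) := by
  have hk2 : (2 : ℝ) ≤ k := by exact_mod_cast hk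
  set F := g P + sumsumDiv d P with hF
  set δ : α → ℝ := fun u => ∑ z ∈ P, d u z with hδ
  have hD := sumsumDiv_nonneg hdnn P
  have hg := hgnn P
  -- the excess of `(k - 1) δ` over `D(P)` is nonnegative on `P`
  have hψ : ∀ z ∈ P, 0 ≤ ((k : ℝ) - 1) * δ z - sumsumDiv d P := by
    intro z _
    have h := sumsumDiv_le_of_le_add hd0 hdsymm (φ := d z)
      (fun u v => (hdtri u z v).trans_eq (by rw [hdsymm u z])) P
    rw [hPcard] at h
    exact sub_nonneg.2 h
  have hψsum : ∑ z ∈ P, (((k : ℝ) - 1) * δ z - sumsumDiv d P) = ((k : ℝ) - 2) * sumsumDiv d P := by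
    rw [Finset.sum_sub_distrib, ← Finset.mul_sum, ← two_mul_sumsumDiv hd0, Finset.sum_const,
      nsmul_eq_mul, hPcard]
    ring
  have hpt : ∀ z ∈ V, ((k : ℝ) - 1) * δ z ≤
      2 * F + if z ∈ P then ((k : ℝ) - 1) * δ z - sumsumDiv d P else 0 := by
    intro z hz
    split_ifs with hzP
    · linarith
    · have h := sum_dist_le_of_notMem_opt hd0 hdsymm hgnn hgmono hgsub hPV
        (by rwa [hPcard]) hz hzP
      rw [hPcard] at h
      linarith
  have htri : ∀ z, δ b ≤ k * d b z + δ z := by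
    intro z
    calc δ b ≤ ∑ y ∈ P, (d b z + d z y) := Finset.sum_le_sum fun y _ => hdtri b z y
      _ = _ := by rw [Finset.sum_add_distrib, Finset.sum_const, nsmul_eq_mul, hPcard]
  have hstep : ∀ i ≤ k, (i : ℝ) * (((k : ℝ) - 1) * δ b) ≤
      ((k : ℝ) - 1) * k * ∑ z ∈ preSet x i, d b z + i * (2 * F) +
        if i = 0 then 0 else ((k : ℝ) - 2) * F := by
    intro i hi
    split_ifs with h0
    · subst h0; simp [preSet]
    have h1 : ∑ z ∈ preSet x i, ((k : ℝ) - 1) * δ b ≤ ∑ z ∈ preSet x i,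
        (((k : ℝ) - 1) * k * d b z + (2 * F +
          if z ∈ P then ((k : ℝ) - 1) * δ z - sumsumDiv d P else 0)) := by
      refine Finset.sum_le_sum fun z hz => ?_
      have := mul_le_mul_of_nonneg_left (htri z) (by linarith : (0 : ℝ) ≤ (k : ℝ) - 1)
      linarith [hpt z (hxV (preSet_subset x i hz))]
    have h2 : ∑ z ∈ preSet x i, (if z ∈ P then ((k : ℝ) - 1) * δ z - sumsumDiv d P else 0) ≤
        ((k : ℝ) - 2) * sumsumDiv d P := by
      rw [← hψsum, ← Finset.sum_filter]
      exact Finset.sum_le_sum_of_subset_of_nonneg (fun z hz => (Finset.mem_filter.1 hz).2)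
        fun z hz _ => hψ z hz
    have h3 : ((k : ℝ) - 2) * sumsumDiv d P ≤ ((k : ℝ) - 2) * F :=
      mul_le_mul_of_nonneg_left (by linarith) (by linarith)
    rw [Finset.sum_add_distrib, Finset.sum_add_distrib, Finset.sum_const, Finset.sum_const,
      nsmul_eq_mul, nsmul_eq_mul, card_preSet hx.1 hi, ← Finset.mul_sum] at h1
    linarith
  have hsum := Finset.sum_le_sum fun i (hi : i ∈ Finset.range k) =>
    hstep i (Finset.mem_range.1 hi).le
  have hgauss : ∑ i ∈ Finset.range k, (i : ℝ) = k * (k - 1) / 2 := by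
    have h := Finset.sum_range_id_mul_two k
    have h' : ((∑ i ∈ Finset.range k, i : ℕ) : ℝ) * 2 = k * ((k - 1 : ℕ) : ℝ) := by exact_mod_cast h
    rw [Nat.cast_sub (by omega)] at h'
    push_cast at h'
    linarith
  have hcount : ∑ i ∈ Finset.range k, (if i = 0 then 0 else ((k : ℝ) - 2) * F) =
      ((k : ℝ) - 1) * (((k : ℝ) - 2) * F) := by
    obtain ⟨l, rfl⟩ : ∃ l, k = l + 1 := ⟨k - 1, by omega⟩
    rw [Finset.sum_range_succ']
    simp
  have hgr := hx.sum_dist_preSet_le hd0 hdsymm hgnn hgmono hbT hb le_rfl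
  rw [preSet_self] at hgr
  have hSF := hgr.trans (hP _ hxV (by rw [Finset.card_image_of_injective _ hx.1]; simp))
  rw [← Finset.sum_mul, Finset.sum_add_distrib, Finset.sum_add_distrib, ← Finset.mul_sum,
    ← Finset.sum_mul, hgauss, hcount] at hsum
  have hpos : (0 : ℝ) < k * (k - 1) := by nlinarith
  have hSF' := mul_le_mul_of_nonneg_left hSF hpos.le
  refine le_of_mul_le_mul_left ?_ hpos
  have hF0 : 0 ≤ ((k : ℝ) - 1) * F := mul_nonneg (by linarith) (by linarith)
  nlinarith

end

/-- Lemma 2: with `T¹, …, Tᵐ` a partition of the finite ground set `U`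
(each part having at least `k` elements), `Sⁱ` the `k`-set selected by the greedy
algorithm (a greedy sequence for `f = g + D` of length `k`) on `Tⁱ`, `O` a `k`-subset of
`U` maximizing `f`, and `OPT(∪ᵢ Sⁱ)` a `k`-subset of `∪ᵢ Sⁱ` maximizing `f` there,
we have `D(O) ≤ 8.5·f(OPT(∪ᵢ Sⁱ))`. -/
theorem stmt11 {α : Type*} [Fintype α] [DecidableEq α]
    (d : α → α → ℝ)
    (hd0 : ∀ u, d u u = 0) (hdnn : ∀ u v, 0 ≤ d u v)
    (hdsymm : ∀ u v, d u v = d v u)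
    (hdtri : ∀ u v w, d u w ≤ d u v + d v w)
    (g : Finset α → ℝ)
    (hgnn : ∀ S : Finset α, 0 ≤ g S)
    (hgmono : ∀ A B : Finset α, A ⊆ B → g A ≤ g B)
    (hgsub : ∀ A B : Finset α, A ⊆ B → ∀ y ∉ B,
      g (insert y B) - g B ≤ g (insert y A) - g A)
    (k m : ℕ) (hk : 10 ≤ k)
    (T : Fin m → Finset α)
    (hdisj : ∀ i j, i ≠ j → Disjoint (T i) (T j))
    (hcover : Finset.univ.biUnion T = (Finset.univ : Finset α))
    (hTk : ∀ i, k ≤ (T i).card)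
    (S : Fin m → Finset α)
    (hS : ∀ i, ∃ x : Fin k → α, IsGreedySeq g d (T i) x ∧ S i = Finset.univ.image x)
    (O : Finset α) (hOcard : O.card = k)
    (hOmax : ∀ R : Finset α, R.card = k →
      g R + sumsumDiv d R ≤ g O + sumsumDiv d O)
    (OPT : Finset α) (hOPTsub : OPT ⊆ Finset.univ.biUnion S) (hOPTcard : OPT.card = k)
    (hOPTmax : ∀ R ⊆ Finset.univ.biUnion S, R.card = k →
      g R + sumsumDiv d R ≤ g OPT + sumsumDiv d OPT) :
    sumsumDiv d O ≤ 8.5 * (g OPT + sumsumDiv d OPT) := by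
  have hk10 : (10 : ℝ) ≤ k := by exact_mod_cast hk
  have hk1 : (0 : ℝ) < (k : ℝ) - 1 := by linarith
  set F := g OPT + sumsumDiv d OPT with hF
  set δ : α → ℝ := fun u => ∑ z ∈ OPT, d u z with hδ
  have hD := sumsumDiv_nonneg hdnn OPT
  have hg := hgnn OPT
  have hδnn : ∀ u, 0 ≤ δ u := fun u => Finset.sum_nonneg fun z _ => hdnn u z
  have hpt : ∀ o, ((k : ℝ) - 1) * δ o ≤ 6 * F + if o ∈ OPT then ((k : ℝ) - 1) * δ o else 0 := by
    intro o
    split_ifs with hoP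
    · linarith
    rw [add_zero]
    have ho : o ∈ Finset.univ.biUnion T := hcover ▸ Finset.mem_univ o
    obtain ⟨i, -, hoT⟩ := Finset.mem_biUnion.1 ho
    obtain ⟨x, hx, hSx⟩ := hS i
    have hSV : S i ⊆ Finset.univ.biUnion S := Finset.subset_biUnion_of_mem S (Finset.mem_univ i)
    by_cases hoS : o ∈ S i
    · have h := sum_dist_le_of_notMem_opt hd0 hdsymm hgnn hgmono hgsub hOPTsub
        (by rwa [hOPTcard]) (hSV hoS) hoP
      rw [hOPTcard] at h
      linarith
    · exact hx.sum_dist_opt_le hd0 hdnn hdsymm hdtri hgnn hgmono hgsub (by omega) (hSx ▸ hSV)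
        hOPTsub hOPTcard hOPTmax hoT (hSx ▸ hoS)
  have hsum : ((k : ℝ) - 1) * ∑ o ∈ O, δ o ≤
      k * (6 * F) + ((k : ℝ) - 1) * (2 * sumsumDiv d OPT) := by
    have h1 := Finset.sum_le_sum fun o (_ : o ∈ O) => hpt o
    rw [← Finset.mul_sum, Finset.sum_add_distrib, Finset.sum_const, nsmul_eq_mul, hOcard,
      ← Finset.sum_filter] at h1
    refine h1.trans (add_le_add_right ?_ _)
    rw [two_mul_sumsumDiv hd0, Finset.mul_sum]
    exact Finset.sum_le_sum_of_subset_of_nonneg (fun z hz => (Finset.mem_filter.1 hz).2)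
      fun z _ _ => mul_nonneg hk1.le (hδnn z)
  have hφ : ∀ u v, d u v ≤ δ u / k + δ v / k := by
    intro u v
    rw [← add_div, le_div_iff₀ (by linarith)]
    calc d u v * k = ∑ z ∈ OPT, d u v := by
          rw [Finset.sum_const, nsmul_eq_mul, hOPTcard, mul_comm]
      _ ≤ ∑ z ∈ OPT, (d u z + d v z) :=
          Finset.sum_le_sum fun z _ => (hdtri u z v).trans_eq (by rw [hdsymm z v])
      _ = _ := Finset.sum_add_distrib
  have h := sumsumDiv_le_of_le_add hd0 hdsymm hφ O
  rw [hOcard, ← Finset.sum_div, ← mul_div_assoc, le_div_iff₀ (by linarith)] at h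
  have h2 : ((k : ℝ) - 1) * (2 * sumsumDiv d OPT) ≤ k * (2 * F) :=
    mul_le_mul (by linarith) (by linarith) (by linarith) (by linarith)
  have h8 : sumsumDiv d O ≤ 8 * F :=
    le_of_mul_le_mul_left (by linarith) (by linarith : (0 : ℝ) < k)
  linarith
end
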